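/- Let p be a prime and let a : ℕ → ℚ_p be a sequence such that (n+1)a_{n+1} ∈ ℤ_p for all n ≥ 0 and such that some (n+1)a_{n+1} is a p-adic unit; let m be the least such n, and assume m < p − 2. For i ≥ 1 set b_i = a_i pⁱ. Then |b_{m+1}|_p = p^{−(m+1)} exactly, and |b_i|_p < p^{−(m+1)} for every integer i > m + 1. In particular the minimum over i ≥ 1 of the p-adic valuations of the b_i is at most m + 1. -/

import Mathlib

/-- For `2 ≤ p`, the function `v ↦ p ^ v - v` on positive `v` is bounded below by `p - 1`. -/
theorem add_le_pow_add_one {p v : ℕ} (hp : 2 ≤ p) (hv : 1 ≤ v) : v + p ≤ p ^ v + 1 := by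
  induction v, hv using Nat.le_induction with
  | base => simp [add_comm]
  | succ v _ ih =>
    have hle : p ^ v * 2 ≤ p ^ (v + 1) := pow_succ p v ▸ Nat.mul_le_mul_left _ hp
    have hpos : 0 < p ^ v := by positivity
    omega


/-- With `a : ℕ → ℚ_p` such that `(n+1)a_{n+1} ∈ ℤ_p` for all `n`, some
`(n+1)a_{n+1}` a unit, `m` the least such index, and `m < p - 2`: setting `b_i = a_i pⁱ`,
one has `|b_{m+1}|_p = p^{-(m+1)}` exactly and `|b_i|_p < p^{-(m+1)}` for all `i > m + 1`. -/
theorem stmt2 (p : ℕ) [hp : Fact p.Prime] (a : ℕ → ℚ_[p])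
    (hint : ∀ n : ℕ, ‖((n + 1 : ℕ) : ℚ_[p]) * a (n + 1)‖ ≤ 1)
    (m : ℕ)
    (hm : ‖((m + 1 : ℕ) : ℚ_[p]) * a (m + 1)‖ = 1)
    (hmin : ∀ n < m, ‖((n + 1 : ℕ) : ℚ_[p]) * a (n + 1)‖ < 1)
    (hmp : m + 2 < p) :
    ‖a (m + 1) * (p : ℚ_[p]) ^ (m + 1)‖ = (p : ℝ) ^ (-((m : ℤ) + 1)) ∧
      ∀ i : ℕ, m + 1 < i → ‖a i * (p : ℚ_[p]) ^ i‖ < (p : ℝ) ^ (-((m : ℤ) + 1)) := by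
  have hp1 : (1 : ℝ) < p := mod_cast hp.out.one_lt
  have hp0 : (p : ℝ) ≠ 0 := by positivity
  constructor
  · have hunit : ‖((m + 1 : ℕ) : ℚ_[p])‖ = 1 := by
      rw [Padic.norm_natCast_eq_one_iff]
      exact Nat.coprime_of_lt_prime (by omega) (by omega) hp.out
    rw [norm_mul, hunit, one_mul] at hm
    rw [norm_mul, hm, one_mul, Padic.norm_p_pow]
    push_cast
    rfl
  · intro i hi
    obtain ⟨v, k, hk, hik⟩ :=
      Nat.exists_eq_pow_mul_and_not_dvd (show i ≠ 0 by omega) p hp.out.ne_one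
    have hnorm : ‖(i : ℚ_[p])‖ = (p : ℝ) ^ (-v : ℤ) := by
      rw [hik, Nat.cast_mul, norm_mul, Nat.cast_pow, Padic.norm_p_pow,
        Padic.norm_natCast_eq_one_iff.mpr ((Nat.Prime.coprime_iff_not_dvd hp.out).mpr hk),
        mul_one]
    have hvi : v + m + 1 < i := by
      rcases Nat.eq_zero_or_pos v with rfl | hv
      · omega
      · have hle := add_le_pow_add_one hp.out.two_le hv
        have hpi : p ^ v ≤ i := Nat.le_of_dvd (by omega) ⟨k, hik⟩
        omega
    have hai : ‖a i‖ ≤ (p : ℝ) ^ (v : ℤ) := by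
      have h := hint (i - 1)
      rw [Nat.sub_add_cancel (by omega), norm_mul, hnorm, zpow_neg] at h
      rwa [inv_mul_le_iff₀ (by positivity), mul_one] at h
    calc ‖a i * (p : ℚ_[p]) ^ i‖ ≤ (p : ℝ) ^ (v : ℤ) * (p : ℝ) ^ (-i : ℤ) := by
          rw [norm_mul, Padic.norm_p_pow]
          gcongr
      _ = (p : ℝ) ^ ((v : ℤ) - i) := by rw [← zpow_add₀ hp0, sub_eq_add_neg]
      _ < (p : ℝ) ^ (-((m : ℤ) + 1)) := zpow_lt_zpow_right₀ hp1 (by omega)
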